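/- (Poincaré inequality on the hypercube) For every positive integer n, every p ∈ [0,1], and every real function f on {0,1}^n: Var_{μ_{n,p}}(f) ≤ ∑_{i=1}^n ∫ (Δ_i f)² dμ_{n,p}. -/

import Mathlib

open Finset

/-- Weight of a point `x ∈ {0,1}^n` under the product Bernoulli(p) measure:
`p^{∑ xᵢ} (1-p)^{∑ (1-xᵢ)}`. -/
noncomputable def muW (n : ℕ) (p : ℝ) (x : Fin n → Bool) : ℝ :=
  ∏ i : Fin n, if x i then p else 1 - p

/-- The measure `μ_{n,p}(A)` of a subset `A ⊆ {0,1}^n`. -/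
noncomputable def muP (n : ℕ) (p : ℝ) (A : Finset (Fin n → Bool)) : ℝ :=
  ∑ x ∈ A, muW n p x

/-- Expectation `∫ f dμ_{n,p}` of a real function on `{0,1}^n`. -/
noncomputable def muE (n : ℕ) (p : ℝ) (f : (Fin n → Bool) → ℝ) : ℝ :=
  ∑ x : Fin n → Bool, muW n p x * f x

/-- `A` is monotone: `x ∈ A` and `x ≤ y` coordinatewise imply `y ∈ A`. -/
def MonotoneSet (n : ℕ) (A : Finset (Fin n → Bool)) : Prop :=
  ∀ x ∈ A, ∀ y : Fin n → Bool, (∀ i, x i ≤ y i) → y ∈ A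

/-- `A` is symmetric: invariant under a transitive subgroup of permutations of coordinates. -/
def SymmetricSet (n : ℕ) (A : Finset (Fin n → Bool)) : Prop :=
  ∃ G : Subgroup (Equiv.Perm (Fin n)),
    (∀ i j : Fin n, ∃ g ∈ G, g i = j) ∧
    (∀ g ∈ G, ∀ x ∈ A, (fun i => x (g⁻¹ i)) ∈ A)

/-- Discrete gradient `∇_i f`. -/
noncomputable def grad (n : ℕ) (i : Fin n) (f : (Fin n → Bool) → ℝ)
    (x : Fin n → Bool) : ℝ :=
  f (Function.update x i true) - f (Function.update x i false)

/-- The operator `Δ_i f = f - ∫ f dμ_{1,p}(x_i)`. -/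
noncomputable def del (n : ℕ) (p : ℝ) (i : Fin n) (f : (Fin n → Bool) → ℝ)
    (x : Fin n → Bool) : ℝ :=
  f x - (p * f (Function.update x i true) + (1 - p) * f (Function.update x i false))

open Classical in
/-- Influence of coordinate `i` on a function `f`: the `μ_{n,p}`-probability
that `f` is not constant on the `i`-th fiber. -/
noncomputable def infl (n : ℕ) (p : ℝ) (i : Fin n) (f : (Fin n → Bool) → ℝ) : ℝ :=
  muP n p (Finset.univ.filter fun x =>
    f (Function.update x i true) ≠ f (Function.update x i false))

open Classical in
/-- Influence of coordinate `i` on a set `A`. -/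
noncomputable def inflSet (n : ℕ) (p : ℝ) (i : Fin n) (A : Finset (Fin n → Bool)) : ℝ :=
  muP n p (Finset.univ.filter fun x =>
    ¬((Function.update x i true ∈ A) ↔ (Function.update x i false ∈ A)))

/-- Entropy of a (nonnegative) function with respect to `μ_{n,p}`. -/
noncomputable def ent (n : ℕ) (p : ℝ) (g : (Fin n → Bool) → ℝ) : ℝ :=
  muE n p (fun x => g x * Real.log (g x)) - muE n p g * Real.log (muE n p g)

/-- Variance of a function with respect to `μ_{n,p}`. -/
noncomputable def varE (n : ℕ) (p : ℝ) (f : (Fin n → Bool) → ℝ) : ℝ :=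
  muE n p (fun x => f x ^ 2) - (muE n p f) ^ 2

/-- Conditional expectation `E[f | x_1, …, x_j]` under `μ_{n,p}`:
average over the last `n - j` coordinates. -/
noncomputable def condE (n : ℕ) (p : ℝ) (j : ℕ) (f : (Fin n → Bool) → ℝ)
    (x : Fin n → Bool) : ℝ :=
  ∑ y : Fin n → Bool,
    (∏ i : Fin n, if (i : ℕ) < j then (if y i = x i then (1 : ℝ) else 0)
      else (if y i then p else 1 - p)) * f y

/-- The logarithmic Sobolev constant of the two-point Bernoulli(p) space. -/
noncomputable def cLS (p : ℝ) : ℝ :=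
  if p = 1 / 2 then 2 else (Real.log (1 - p) - Real.log p) / (1 - 2 * p)

/-- The sequence `s(n)` of Theorem 4.1. -/
noncomputable def sseq (n : ℕ) : ℝ :=
  Real.log n -
    max (Real.log ((Real.exp 1 ^ (2 + 4 / Real.exp 1) / (2 : ℝ) ^ (5 + 4 / Real.exp 1)) *
        Real.log ((n : ℝ) / Real.log n ^ 2) ^ (3 + 4 / Real.exp 1)))
      (2 * Real.log (Real.log n))

theorem muE_succ (n : ℕ) (p : ℝ) (f : (Fin (n + 1) → Bool) → ℝ) :
    muE (n + 1) p f = p * muE n p (fun x => f (Fin.cons true x))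
      + (1 - p) * muE n p (fun x => f (Fin.cons false x)) := by
  unfold muE muW
  rw [← (Fin.consEquiv (fun _ : Fin (n + 1) => Bool)).sum_comp, Fintype.sum_prod_type,
    Fintype.sum_bool, Finset.mul_sum, Finset.mul_sum]
  congr 1 <;>
  · refine Finset.sum_congr rfl fun x _ => ?_
    simp [Fin.consEquiv, Fin.prod_univ_succ, mul_assoc]

theorem muE_add (n : ℕ) (p : ℝ) (f g : (Fin n → Bool) → ℝ) :
    muE n p (fun x => f x + g x) = muE n p f + muE n p g := by
  simp [muE, mul_add, Finset.sum_add_distrib]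

theorem muE_sub (n : ℕ) (p : ℝ) (f g : (Fin n → Bool) → ℝ) :
    muE n p (fun x => f x - g x) = muE n p f - muE n p g := by
  simp [muE, mul_sub, Finset.sum_sub_distrib]

theorem muE_smul (n : ℕ) (p c : ℝ) (f : (Fin n → Bool) → ℝ) :
    muE n p (fun x => c * f x) = c * muE n p f := by
  simp only [muE, Finset.mul_sum]
  exact Finset.sum_congr rfl fun x _ => by ring

theorem muE_sq_le (p : ℝ) (hp : p ∈ Set.Icc (0 : ℝ) 1) (n : ℕ) :
    ∀ f : (Fin n → Bool) → ℝ, muE n p f ^ 2 ≤ muE n p (fun x => f x ^ 2) := by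
  obtain ⟨h0, h1⟩ := hp
  induction n with
  | zero => intro f; simp [muE, muW]
  | succ n ih =>
    intro f
    rw [muE_succ, muE_succ]
    have ha := mul_le_mul_of_nonneg_left (ih fun x => f (Fin.cons true x)) h0
    have hb := mul_le_mul_of_nonneg_left (ih fun x => f (Fin.cons false x)) (sub_nonneg.2 h1)
    set a := muE n p fun x => f (Fin.cons true x)
    set b := muE n p fun x => f (Fin.cons false x)
    have := mul_nonneg (mul_nonneg h0 (sub_nonneg.2 h1)) (sq_nonneg (a - b))
    linear_combination ha + hb + this

theorem poincare_aux (p : ℝ) (hp : p ∈ Set.Icc (0 : ℝ) 1) (n : ℕ) :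
    ∀ f : (Fin n → Bool) → ℝ,
    varE n p f ≤ ∑ i : Fin n, muE n p (fun x => del n p i f x ^ 2) := by
  have ⟨h0, h1⟩ := hp
  induction n with
  | zero => intro f; simp [varE, muE, muW]
  | succ n ih =>
    intro f
    rw [Fin.sum_univ_succ]
    have hd : ∀ (b : Bool) (i : Fin n) (x : Fin n → Bool),
        del (n + 1) p i.succ f (Fin.cons b x) = del n p i (fun x => f (Fin.cons b x)) x := by
      intro b i x
      simp only [del, Fin.cons_update]
    have ht : ∀ x : Fin n → Bool, del (n + 1) p 0 f (Fin.cons true x) ^ 2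
        = (1 - p) ^ 2 * (f (Fin.cons true x) - f (Fin.cons false x)) ^ 2 := by
      intro x
      simp only [del, Fin.update_cons_zero]
      ring
    have hf : ∀ x : Fin n → Bool, del (n + 1) p 0 f (Fin.cons false x) ^ 2
        = p ^ 2 * (f (Fin.cons true x) - f (Fin.cons false x)) ^ 2 := by
      intro x
      simp only [del, Fin.update_cons_zero]
      ring
    simp only [varE, muE_succ, hd, ht, hf, muE_smul, Finset.sum_add_distrib, ← Finset.mul_sum]
    have ha := mul_le_mul_of_nonneg_left (ih fun x => f (Fin.cons true x)) h0
    have hb := mul_le_mul_of_nonneg_left (ih fun x => f (Fin.cons false x)) (sub_nonneg.2 h1)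
    have hs := mul_le_mul_of_nonneg_left
      (muE_sq_le p hp n fun x => f (Fin.cons true x) - f (Fin.cons false x))
      (mul_nonneg h0 (sub_nonneg.2 h1))
    rw [muE_sub] at hs
    simp only [varE] at ha hb
    linear_combination ha + hb + hs

/-- Poincaré inequality (9): `Var_{μ_p}(f) ≤ ∑ᵢ ∫ (Δᵢ f)² dμ_p`. -/
theorem stmt11 (n : ℕ) (hn : 0 < n) (p : ℝ) (hp : p ∈ Set.Icc (0 : ℝ) 1)
    (f : (Fin n → Bool) → ℝ) :
    varE n p f ≤ ∑ i : Fin n, muE n p (fun x => del n p i f x ^ 2) :=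
  poincare_aux p hp n f
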